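/- arXiv:1006.5105 — 2 statements merged into one kernel-verified Lean document; each statement's English description precedes it below -/
import Mathlib

section
/- Let N be a positive integer, p a prime dividing N, and v = val_p(N). Let γ_p ∈ Sp(4, ℤ) be any matrix with γ_p ≡ M (mod p^v) and γ_p ≡ 1₄ (mod N p^{−v}), where M is the 4×4 matrix with (1,4)- and (2,3)-entries 1, (3,2)- and (4,1)-entries −1, and all other entries 0; set U_p = γ_p · diag(p^v, p^v, 1, 1). Then U_p normalizes Γ^para(N): U_p Γ^para(N) U_p⁻¹ = Γ^para(N). -/
open Matrix

/-- The standard symplectic matrix `J = [[0, 1₂], [−1₂, 0]]` in 2×2 block form. -/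
def Jmat (R : Type*) [CommRing R] : Matrix (Fin 4) (Fin 4) R :=
  !![0, 0, 1, 0;
     0, 0, 0, 1;
     -1, 0, 0, 0;
     0, -1, 0, 0]

/-- The matrix `M` with (1,4)- and (2,3)-entries 1, (3,2)- and (4,1)-entries −1,
and all other entries 0. -/
def Mmat : Matrix (Fin 4) (Fin 4) ℤ :=
  !![0, 0, 0, 1;
     0, 0, 1, 0;
     0, -1, 0, 0;
     -1, 0, 0, 0]

/-- Membership in the paramodular group `Γ^para(N)`: `g ∈ Sp(4, ℚ)` (i.e.
`gᵀ J g = J`) together with the integrality conditions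
`g₁₂, g₃₂, g₄₁, g₄₂, g₄₃ ∈ Nℤ`, `g₂₄ ∈ N⁻¹ℤ`, and all remaining entries in `ℤ`. -/
def ParaMem (N : ℕ) (g : Matrix (Fin 4) (Fin 4) ℚ) : Prop :=
  gᵀ * Jmat ℚ * g = Jmat ℚ ∧
  (∃ a : ℤ, g 0 1 = N * a) ∧ (∃ a : ℤ, g 2 1 = N * a) ∧ (∃ a : ℤ, g 3 0 = N * a) ∧
  (∃ a : ℤ, g 3 1 = N * a) ∧ (∃ a : ℤ, g 3 2 = N * a) ∧
  (∃ a : ℤ, g 1 3 = a / N) ∧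
  (∃ a : ℤ, g 0 0 = a) ∧ (∃ a : ℤ, g 0 2 = a) ∧ (∃ a : ℤ, g 0 3 = a) ∧
  (∃ a : ℤ, g 1 0 = a) ∧ (∃ a : ℤ, g 1 1 = a) ∧ (∃ a : ℤ, g 1 2 = a) ∧
  (∃ a : ℤ, g 2 0 = a) ∧ (∃ a : ℤ, g 2 2 = a) ∧ (∃ a : ℤ, g 2 3 = a) ∧
  (∃ a : ℤ, g 3 3 = a)

/-- `A i j` is an integer multiple of `q ^ e i j * m ^ f i j` for all `i`, `j`. -/
def HasWeights (q m : ℕ) (e f : Matrix (Fin 4) (Fin 4) ℤ) (A : Matrix (Fin 4) (Fin 4) ℚ) : Prop :=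
  ∀ i j, ∃ n : ℤ, A i j = (q : ℚ) ^ e i j * (m : ℚ) ^ f i j * n

/-- The `q`-exponents (and the `m`-exponents) of the paramodular order of level `q * m`. -/
def paraExp : Matrix (Fin 4) (Fin 4) ℤ :=
  !![0, 1, 0, 0;
     0, 0, 0, -1;
     0, 1, 0, 0;
     1, 1, 1, 0]

/-- The `q`-exponents of the Atkin-Lehner coset. -/
def atkinLehnerExp : Matrix (Fin 4) (Fin 4) ℤ :=
  !![1, 1, 1, 0;
     0, 1, 0, 0;
     1, 1, 1, 0;
     1, 2, 1, 1]

/-- The exponents of `q` in a matrix congruent to `Mmat` modulo `q`. -/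
def antidiagExp : Matrix (Fin 4) (Fin 4) ℤ :=
  !![1, 1, 1, 0;
     1, 1, 0, 1;
     1, 0, 1, 1;
     0, 1, 1, 1]

/-- The exponents of `m` in a matrix congruent to `1` modulo `m`. -/
def diagExp : Matrix (Fin 4) (Fin 4) ℤ :=
  !![0, 1, 1, 1;
     1, 0, 1, 1;
     1, 1, 0, 1;
     1, 1, 1, 0]

/-- Exponents satisfied by `Jmat`; those at its zero entries are arbitrary, and chosen large. -/
def sympExp : Matrix (Fin 4) (Fin 4) ℤ :=
  !![4, 4, 0, 4;
     4, 4, 4, 0;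
     0, 4, 4, 4;
     4, 0, 4, 4]

/-- Exponents of a diagonal matrix with entries `q ^ d i`; those off the diagonal are arbitrary,
and chosen large. -/
def diagonalExp (d : Fin 4 → ℤ) : Matrix (Fin 4) (Fin 4) ℤ :=
  fun i j => if i = j then d i else 4

theorem exists_zpow_eq_zpow_mul {q : ℕ} (hq : 0 < q) {a b : ℤ} (h : a ≤ b) :
    ∃ n : ℤ, (q : ℚ) ^ b = (q : ℚ) ^ a * n := by
  have hq' : (q : ℚ) ≠ 0 := by positivity
  refine ⟨(q : ℤ) ^ (b - a).toNat, ?_⟩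
  push_cast
  rw [← zpow_natCast, Int.toNat_of_nonneg (by lia), ← zpow_add₀ hq']
  congr 1
  ring

namespace HasWeights

variable {q m : ℕ} {e f e' f' e'' f'' : Matrix (Fin 4) (Fin 4) ℤ}
  {A B : Matrix (Fin 4) (Fin 4) ℚ}

theorem mul (hq : 0 < q) (hm : 0 < m) (hA : HasWeights q m e f A) (hB : HasWeights q m e' f' B)
    (he : ∀ i k j, e'' i j ≤ e i k + e' k j) (hf : ∀ i k j, f'' i j ≤ f i k + f' k j) :
    HasWeights q m e'' f'' (A * B) := by
  have hq' : (q : ℚ) ≠ 0 := by positivity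
  have hm' : (m : ℚ) ≠ 0 := by positivity
  intro i j
  have key : ∀ k, ∃ n : ℤ, A i k * B k j = (q : ℚ) ^ e'' i j * (m : ℚ) ^ f'' i j * n := by
    intro k
    obtain ⟨a, ha⟩ := hA i k
    obtain ⟨b, hb⟩ := hB k j
    obtain ⟨c, hc⟩ := exists_zpow_eq_zpow_mul hq (he i k j)
    obtain ⟨d, hd⟩ := exists_zpow_eq_zpow_mul hm (hf i k j)
    rw [zpow_add₀ hq'] at hc
    rw [zpow_add₀ hm'] at hd
    refine ⟨c * d * a * b, ?_⟩
    push_cast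
    rw [ha, hb]
    linear_combination (a * b * (m : ℚ) ^ f i k * (m : ℚ) ^ f' k j) * hc +
      (a * b * (q : ℚ) ^ e'' i j * c) * hd
  choose n hn using key
  refine ⟨∑ k, n k, ?_⟩
  rw [Matrix.mul_apply, Int.cast_sum, Finset.mul_sum]
  exact Finset.sum_congr rfl fun k _ => hn k

theorem neg (hA : HasWeights q m e f A) : HasWeights q m e f (-A) := by
  intro i j
  obtain ⟨a, ha⟩ := hA i j
  exact ⟨-a, by rw [Matrix.neg_apply, ha]; push_cast; ring⟩

theorem transpose (hA : HasWeights q m e f A) : HasWeights q m eᵀ fᵀ Aᵀ :=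
  fun i j => hA j i

theorem inv_smul (hq : 0 < q) (hA : HasWeights q m (fun i j => e i j + 1) f A) :
    HasWeights q m e f ((q : ℚ)⁻¹ • A) := by
  have hq' : (q : ℚ) ≠ 0 := by positivity
  intro i j
  obtain ⟨a, ha⟩ := hA i j
  refine ⟨a, ?_⟩
  rw [Matrix.smul_apply, ha, zpow_add_one₀ hq', smul_eq_mul]
  field_simp

end HasWeights

theorem hasWeights_Jmat (q m : ℕ) : HasWeights q m sympExp sympExp (Jmat ℚ) := by
  intro i j
  fin_cases i <;> fin_cases j <;> simp [Jmat, sympExp] <;>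
    first
      | exact ⟨1, Int.cast_one.symm⟩
      | exact ⟨-1, by norm_num⟩

theorem hasWeights_diagonal (q m : ℕ) (d : Fin 4 → ℤ) :
    HasWeights q m (diagonalExp d) (diagonalExp 0) (Matrix.diagonal fun i => (q : ℚ) ^ d i) := by
  intro i j
  by_cases h : i = j
  · subst h
    exact ⟨1, by simp [diagonalExp]⟩
  · exact ⟨0, by simp [h]⟩

theorem paraMem_iff (q m : ℕ) (g : Matrix (Fin 4) (Fin 4) ℚ) :
    ParaMem (q * m) g ↔ gᵀ * Jmat ℚ * g = Jmat ℚ ∧ HasWeights q m paraExp paraExp g := by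
  have h : ∀ a : ℤ, (q : ℚ)⁻¹ * (m : ℚ)⁻¹ * a = a / (q * m) := fun a => by
    rw [div_eq_mul_inv, mul_inv]; ring
  simp only [ParaMem, HasWeights, Fin.forall_fin_succ]
  simp [paraExp, h]
  tauto

/-- Conjugation by a similitude preserves the symplectic relation. -/
theorem symplectic_conj {n R : Type*} [Fintype n] [DecidableEq n] [CommRing R]
    {J A B g : Matrix n n R} {c : R} (hA : Aᵀ * J * A = c • J) (hAB : A * B = 1)
    (hg : gᵀ * J * g = J) : (A * g * B)ᵀ * J * (A * g * B) = J := by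
  have hBA : Bᵀ * Aᵀ = 1 := by rw [← Matrix.transpose_mul, hAB, Matrix.transpose_one]
  calc (A * g * B)ᵀ * J * (A * g * B) = Bᵀ * (gᵀ * (Aᵀ * J * A) * g) * B := by
        simp only [Matrix.transpose_mul, Matrix.mul_assoc]
    _ = Bᵀ * (c • J) * B := by rw [hA, Matrix.mul_smul, Matrix.smul_mul, hg]
    _ = (Bᵀ * Aᵀ) * J * (A * B) := by rw [← hA]; simp only [Matrix.mul_assoc]
    _ = J := by rw [hBA, hAB, Matrix.one_mul, Matrix.mul_one]

theorem Jmat_mul_Jmat (R : Type*) [CommRing R] : Jmat R * Jmat R = -1 := by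
  ext i j
  fin_cases i <;> fin_cases j <;> simp [Jmat, Matrix.mul_apply, Fin.sum_univ_four]

theorem hasWeights_map_of_congr {q m : ℕ} (hqm : q.Coprime m) {γ : Matrix (Fin 4) (Fin 4) ℤ}
    (hγM : ∀ i j, (q : ℤ) ∣ γ i j - Mmat i j)
    (hγ1 : ∀ i j, (m : ℤ) ∣ γ i j - (1 : Matrix (Fin 4) (Fin 4) ℤ) i j) :
    HasWeights q m antidiagExp diagExp (γ.map (fun x => (x : ℚ))) := by
  have hcop : IsCoprime (q : ℤ) (m : ℤ) := Nat.isCoprime_iff_coprime.mpr hqm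
  have hq : ∀ i j, Mmat i j = 0 → (q : ℤ) ∣ γ i j := fun i j h => by simpa [h] using hγM i j
  have hm : ∀ i j, i ≠ j → (m : ℤ) ∣ γ i j := fun i j h => by
    simpa [Matrix.one_apply_ne h] using hγ1 i j
  have hM : ∀ i j : Fin 4, Mmat i j = 0 ∧ antidiagExp i j = 1 ∨ i ≠ j ∧ antidiagExp i j = 0 := by
    intro i j; fin_cases i <;> fin_cases j <;> simp [Mmat, antidiagExp]
  have h1 : ∀ i j : Fin 4, i ≠ j ∧ diagExp i j = 1 ∨ Mmat i j = 0 ∧ diagExp i j = 0 := by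
    intro i j; fin_cases i <;> fin_cases j <;> simp [Mmat, diagExp]
  intro i j
  rcases hM i j with ⟨hz, he⟩ | ⟨hne, he⟩ <;> rcases h1 i j with ⟨hne', hf⟩ | ⟨hz', hf⟩
  · obtain ⟨n, hn⟩ := hcop.mul_dvd (hq i j hz) (hm i j hne')
    exact ⟨n, by simp [he, hf, hn]⟩
  · obtain ⟨n, hn⟩ := hq i j hz
    exact ⟨n, by simp [he, hf, hn]⟩
  · obtain ⟨n, hn⟩ := hm i j hne
    exact ⟨n, by simp [he, hf, hn]⟩
  · exact ⟨γ i j, by simp [he, hf]⟩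

theorem HasWeights.conj {q m : ℕ} (hq : 0 < q) (hm : 0 < m) {A g B : Matrix (Fin 4) (Fin 4) ℚ}
    (hA : HasWeights q m atkinLehnerExp paraExp A) (hg : HasWeights q m paraExp paraExp g)
    (hB : HasWeights q m atkinLehnerExp paraExp B) :
    HasWeights q m paraExp paraExp ((q : ℚ)⁻¹ • (A * g * B)) :=
  have hAg : HasWeights q m atkinLehnerExp paraExp (A * g) :=
    hA.mul hq hm hg (by decide) (by decide)
  (hAg.mul hq hm hB (by decide) (by decide)).inv_smul hq

/-- Let `N` be a positive integer, `p` a prime dividing `N`, `v = val_p(N)`, and let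
`γ_p ∈ Sp(4, ℤ)` satisfy `γ_p ≡ M (mod p^v)` and `γ_p ≡ 1₄ (mod N p^{−v})`. Set
`U_p = γ_p · diag(p^v, p^v, 1, 1)`. Then `U_p` normalizes `Γ^para(N)`:
`U_p Γ^para(N) U_p⁻¹ = Γ^para(N)`. -/
theorem atkin_lehner_normalizes (N p : ℕ) (hN : 0 < N) (hp : p.Prime) (hpN : p ∣ N)
    (v : ℕ) (hv : v = N.factorization p)
    (γ : Matrix (Fin 4) (Fin 4) ℤ)
    (hγSp : γᵀ * Jmat ℤ * γ = Jmat ℤ)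
    (hγM : ∀ i j : Fin 4, ((p : ℤ) ^ v) ∣ (γ i j - Mmat i j))
    (hγ1 : ∀ i j : Fin 4, ((N / p ^ v : ℕ) : ℤ) ∣
      (γ i j - (1 : Matrix (Fin 4) (Fin 4) ℤ) i j))
    (U : Matrix (Fin 4) (Fin 4) ℚ)
    (hU : U = (γ.map (fun x => (x : ℚ))) *
      Matrix.diagonal ![(p : ℚ) ^ v, (p : ℚ) ^ v, 1, 1]) :
    (fun g => U * g * U⁻¹) '' {g | ParaMem N g} = {g | ParaMem N g} := by
  set q : ℕ := p ^ v with hq_def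
  set m : ℕ := N / q with hm_def
  have hq : 0 < q := pow_pos hp.pos v
  have hNqm : N = q * m := by
    rw [hm_def, hq_def, hv]; exact (Nat.ordProj_mul_ordCompl_eq_self N p).symm
  have hm : 0 < m := Nat.pos_of_mul_pos_left (hNqm ▸ hN)
  have hqm : q.Coprime m := by
    rw [hm_def, hq_def, hv]
    exact (Nat.coprime_ordCompl hp hN.ne').pow_left _
  have hq' : (q : ℚ) ≠ 0 := by positivity
  set G : Matrix (Fin 4) (Fin 4) ℚ := γ.map (fun x => (x : ℚ))
  have hGw : HasWeights q m antidiagExp diagExp G :=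
    hasWeights_map_of_congr hqm (fun i j => by simpa [hq_def] using hγM i j) hγ1
  have hGSp : Gᵀ * Jmat ℚ * G = Jmat ℚ := by
    have hJ : (Jmat ℤ).map (Int.castRingHom ℚ) = Jmat ℚ := by
      ext i j; fin_cases i <;> fin_cases j <;> simp [Jmat]
    have h := congrArg (fun A => A.map (Int.castRingHom ℚ)) hγSp
    simp only [Matrix.map_mul, Matrix.transpose_map, hJ] at h
    exact h
  set D : Matrix (Fin 4) (Fin 4) ℚ := Matrix.diagonal fun i => (q : ℚ) ^ (![1, 1, 0, 0] i : ℤ)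
  set D' : Matrix (Fin 4) (Fin 4) ℚ := Matrix.diagonal fun i => (q : ℚ) ^ (![0, 0, 1, 1] i : ℤ)
  have hUD : U = G * D := by
    rw [hU]
    congr 2
    ext i
    fin_cases i <;> simp [hq_def]
  have hDD' : D * D' = (q : ℚ) • 1 := by
    ext i j
    fin_cases i <;> fin_cases j <;> simp [D, D']
  have hDJ : Dᵀ * Jmat ℚ * D = (q : ℚ) • Jmat ℚ := by
    ext i j
    fin_cases i <;> fin_cases j <;> simp [D, Jmat]
  have hUJ : Uᵀ * Jmat ℚ * U = (q : ℚ) • Jmat ℚ := by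
    calc Uᵀ * Jmat ℚ * U = Dᵀ * (Gᵀ * Jmat ℚ * G) * D := by
          rw [hUD]; simp only [Matrix.transpose_mul, Matrix.mul_assoc]
      _ = (q : ℚ) • Jmat ℚ := by rw [hGSp, hDJ]
  set K : Matrix (Fin 4) (Fin 4) ℚ := -(Jmat ℚ * (Gᵀ * Jmat ℚ))
  have hGK : G * K = 1 := by
    rw [mul_eq_one_comm]
    simp only [K, Matrix.neg_mul, Matrix.mul_assoc]
    rw [← Matrix.mul_assoc Gᵀ, hGSp, Jmat_mul_Jmat, neg_neg]
  have hUV : U * (D' * K) = (q : ℚ) • 1 := by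
    rw [hUD, Matrix.mul_assoc, ← Matrix.mul_assoc D, hDD', Matrix.smul_mul, Matrix.one_mul,
      Matrix.mul_smul, hGK]
  have hUB : U * ((q : ℚ)⁻¹ • (D' * K)) = 1 := by
    rw [Matrix.mul_smul, hUV, smul_smul, inv_mul_cancel₀ hq', one_smul]
  have hUinv : U⁻¹ = (q : ℚ)⁻¹ • (D' * K) := Matrix.inv_eq_right_inv hUB
  have hUU : U * U⁻¹ = 1 := hUinv ▸ hUB
  have hUU' : U⁻¹ * U = 1 := mul_eq_one_comm.mp hUU
  have hUJ' : (U⁻¹)ᵀ * Jmat ℚ * U⁻¹ = (q : ℚ)⁻¹ • Jmat ℚ := by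
    have hT : (U⁻¹)ᵀ * Uᵀ = 1 := by rw [← Matrix.transpose_mul, hUU, Matrix.transpose_one]
    calc (U⁻¹)ᵀ * Jmat ℚ * U⁻¹ = (q : ℚ)⁻¹ • ((U⁻¹)ᵀ * ((q : ℚ) • Jmat ℚ) * U⁻¹) := by
          rw [Matrix.mul_smul, Matrix.smul_mul, smul_smul, inv_mul_cancel₀ hq', one_smul]
      _ = (q : ℚ)⁻¹ • (((U⁻¹)ᵀ * Uᵀ) * Jmat ℚ * (U * U⁻¹)) := by
          rw [← hUJ]; simp only [Matrix.mul_assoc]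
      _ = (q : ℚ)⁻¹ • Jmat ℚ := by rw [hT, hUU, Matrix.one_mul, Matrix.mul_one]
  have hUw : HasWeights q m atkinLehnerExp paraExp U := by
    rw [hUD]
    exact hGw.mul hq hm (hasWeights_diagonal q m _) (by decide) (by decide)
  have hKw : HasWeights q m antidiagExp diagExp K := by
    have h : HasWeights q m (antidiagExp.submatrix id ![2, 3, 0, 1])
        (diagExp.submatrix id ![2, 3, 0, 1]) (Gᵀ * Jmat ℚ) :=
      hGw.transpose.mul hq hm (hasWeights_Jmat q m) (by decide) (by decide)
    exact ((hasWeights_Jmat q m).mul hq hm h (by decide) (by decide)).neg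
  have hVw : HasWeights q m atkinLehnerExp paraExp (D' * K) :=
    (hasWeights_diagonal q m _).mul hq hm hKw (by decide) (by decide)
  rw [hNqm]
  ext g
  simp only [Set.mem_image, Set.mem_ofPred_eq, paraMem_iff]
  constructor
  · rintro ⟨g, ⟨hgJ, hgw⟩, rfl⟩
    refine ⟨symplectic_conj hUJ hUU hgJ, ?_⟩
    rw [hUinv, Matrix.mul_smul]
    exact hUw.conj hq hm hgw hVw
  · rintro ⟨hgJ, hgw⟩
    refine ⟨U⁻¹ * g * U, ⟨symplectic_conj hUJ' hUU' hgJ, ?_⟩, ?_⟩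
    · rw [hUinv, Matrix.smul_mul, Matrix.smul_mul]
      exact hVw.conj hq hm hgw hUw
    · calc U * (U⁻¹ * g * U) * U⁻¹ = (U * U⁻¹) * g * (U * U⁻¹) := by
            simp only [Matrix.mul_assoc]
        _ = g := by rw [hUU, Matrix.one_mul, Matrix.mul_one]
end

section
/- Let N be a positive integer, p a prime dividing N, and v = val_p(N). Let γ_p ∈ Sp(4, ℤ) be any matrix with γ_p ≡ M (mod p^v) and γ_p ≡ 1₄ (mod N p^{−v}), where M is the 4×4 matrix with (1,4)- and (2,3)-entries 1, (3,2)- and (4,1)-entries −1, and all other entries 0; set U_p = γ_p · diag(p^v, p^v, 1, 1). Then U_p² ∈ p^v Γ^para(N), i.e. there exists δ ∈ Γ^para(N) with U_p² = p^v · δ. -/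
open Matrix

/-- The matrix `diag(q, q, 1, 1)`. -/
def scaleDiag (q : ℤ) : Matrix (Fin 4) (Fin 4) ℤ :=
  Matrix.diagonal ![q, q, 1, 1]

theorem scaleDiag_mul_Mmat_mul_scaleDiag (q : ℤ) :
    scaleDiag q * Mmat * scaleDiag q = q • Mmat := by
  ext i j
  fin_cases i <;> fin_cases j <;> simp [scaleDiag, Mmat]

theorem scaleDiag_symplectic (q : ℤ) :
    (scaleDiag q)ᵀ * Jmat ℤ * scaleDiag q = q • Jmat ℤ := by
  ext i j
  fin_cases i <;> fin_cases j <;> simp [scaleDiag, Jmat]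

/-- If every entry of `A - B` is divisible by `k`, then `A = B + k • X` for some `X`. -/
theorem exists_eq_add_smul {n : Type*} (k : ℤ) (A B : Matrix n n ℤ)
    (h : ∀ i j, k ∣ A i j - B i j) : ∃ X : Matrix n n ℤ, A = B + k • X := by
  choose X hX using h
  refine ⟨Matrix.of X, ?_⟩
  ext i j
  simp [← hX]

/-- The quotient of `((M + q X) diag(q, q, 1, 1))²` by `q`. -/
def squareQuotient (q : ℤ) (X : Matrix (Fin 4) (Fin 4) ℤ) : Matrix (Fin 4) (Fin 4) ℤ :=
  Mmat * Mmat + q • (X * Mmat) + Mmat * scaleDiag q * X * scaleDiag q +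
    q • (X * scaleDiag q * X * scaleDiag q)

theorem mul_scaleDiag_sq (q : ℤ) (X : Matrix (Fin 4) (Fin 4) ℤ) :
    (Mmat + q • X) * scaleDiag q * ((Mmat + q • X) * scaleDiag q) =
      q • squareQuotient q X := by
  have h := scaleDiag_mul_Mmat_mul_scaleDiag q
  have h₁ : ∀ A : Matrix (Fin 4) (Fin 4) ℤ,
      A * scaleDiag q * (Mmat * scaleDiag q) = q • (A * Mmat) := by
    intro A
    rw [← Matrix.mul_smul, ← h]
    simp only [Matrix.mul_assoc]
  simp only [add_mul, mul_add, h₁, squareQuotient, smul_add, Matrix.smul_mul, Matrix.mul_smul,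
    Matrix.mul_assoc]
  abel

/-- Modulo `q`, the matrix `squareQuotient q X` has zero off-diagonal entries outside the
upper right block. -/
theorem dvd_squareQuotient (q : ℤ) (X : Matrix (Fin 4) (Fin 4) ℤ) (i j : Fin 4) (hij : i ≠ j)
    (h : 2 ≤ i ∨ j < 2) : q ∣ squareQuotient q X i j := by
  have h₁ : q ∣ (Mmat * Mmat + Mmat * scaleDiag q * X * scaleDiag q) i j := by
    simp only [scaleDiag, Matrix.add_apply, Matrix.mul_apply,
      Fin.sum_univ_four]
    fin_cases i <;> fin_cases j <;> revert hij h <;> simp [Mmat]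
  have h₂ : squareQuotient q X i j =
      (Mmat * Mmat + Mmat * scaleDiag q * X * scaleDiag q) i j +
        q * (X * Mmat + X * scaleDiag q * X * scaleDiag q) i j := by
    simp only [squareQuotient, Matrix.add_apply, Matrix.smul_apply, smul_eq_mul]
    ring
  rw [h₂]
  exact dvd_add h₁ (dvd_mul_right _ _)

theorem dvd_sq_of_eq_one_add_smul (q m : ℤ) (Y : Matrix (Fin 4) (Fin 4) ℤ) (i j : Fin 4)
    (hij : i ≠ j) :
    m ∣ ((1 + m • Y) * scaleDiag q * ((1 + m • Y) * scaleDiag q)) i j := by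
  have h : (1 + m • Y) * scaleDiag q * ((1 + m • Y) * scaleDiag q) =
      scaleDiag q * scaleDiag q + m • (scaleDiag q * (Y * scaleDiag q) +
        Y * scaleDiag q * ((1 + m • Y) * scaleDiag q)) := by
    simp only [add_mul, mul_add, one_mul, smul_add, Matrix.smul_mul, Matrix.mul_smul]
    abel
  rw [h, Matrix.add_apply, Matrix.smul_apply, scaleDiag, Matrix.diagonal_mul_diagonal,
    Matrix.diagonal_apply_ne _ hij, zero_add]
  exact dvd_mul_right _ _

/-- The square of a symplectic similitude with multiplier `q`, divided by `q`, is symplectic. -/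
theorem symplectic_of_sq_eq_smul {q : ℤ} (hq : q ≠ 0) {E D : Matrix (Fin 4) (Fin 4) ℤ}
    (hE : Eᵀ * Jmat ℤ * E = q • Jmat ℤ) (hD : E * E = q • D) :
    Dᵀ * Jmat ℤ * D = Jmat ℤ := by
  have h : (q * q) • (Dᵀ * Jmat ℤ * D) = (q * q) • Jmat ℤ := calc
    (q * q) • (Dᵀ * Jmat ℤ * D) = (q • D)ᵀ * Jmat ℤ * (q • D) := by
      simp only [Matrix.transpose_smul, Matrix.smul_mul, Matrix.mul_smul, smul_smul]
    _ = Eᵀ * (Eᵀ * Jmat ℤ * E) * E := by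
      rw [← hD, Matrix.transpose_mul]
      simp only [Matrix.mul_assoc]
    _ = (q * q) • Jmat ℤ := by
      rw [hE, Matrix.mul_smul, Matrix.smul_mul, hE, smul_smul]
  exact smul_right_injective _ (mul_ne_zero hq hq) h

/-- An integral symplectic matrix with the required entries divisible by `N` is paramodular. -/
theorem paraMem_map_intCast {N : ℕ} (hN : 0 < N) (D : Matrix (Fin 4) (Fin 4) ℤ)
    (hD : Dᵀ * Jmat ℤ * D = Jmat ℤ)
    (h : ∀ i j : Fin 4, i ≠ j → (2 ≤ i ∨ j < 2) → i = 3 ∨ j = 1 → (N : ℤ) ∣ D i j) :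
    ParaMem N (D.map (fun x => (x : ℚ))) := by
  have hN' : (N : ℚ) ≠ 0 := by positivity
  have hJ : (Jmat ℤ).map (Int.castRingHom ℚ) = Jmat ℚ := by
    ext i j
    fin_cases i <;> fin_cases j <;> simp [Jmat]
  have hdiv : ∀ i j : Fin 4, i ≠ j → (2 ≤ i ∨ j < 2) → i = 3 ∨ j = 1 →
      ∃ a : ℤ, D.map (fun x => (x : ℚ)) i j = N * a := by
    intro i j h₁ h₂ h₃
    obtain ⟨a, ha⟩ := h i j h₁ h₂ h₃
    exact ⟨a, by simp [ha]⟩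
  refine ⟨?_, hdiv 0 1 (by decide) (by decide) (by decide),
    hdiv 2 1 (by decide) (by decide) (by decide), hdiv 3 0 (by decide) (by decide) (by decide),
    hdiv 3 1 (by decide) (by decide) (by decide), hdiv 3 2 (by decide) (by decide) (by decide),
    ⟨N * D 1 3, by simp [hN']⟩, ⟨_, rfl⟩, ⟨_, rfl⟩, ⟨_, rfl⟩, ⟨_, rfl⟩, ⟨_, rfl⟩, ⟨_, rfl⟩,
    ⟨_, rfl⟩, ⟨_, rfl⟩, ⟨_, rfl⟩, ⟨_, rfl⟩⟩
  have h₁ := congrArg (fun A => A.map (Int.castRingHom ℚ)) hD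
  simp only [Matrix.map_mul, hJ] at h₁
  exact h₁

/-- Let `N` be a positive integer, `p` a prime dividing `N`, `v = val_p(N)`, and let
`γ_p ∈ Sp(4, ℤ)` satisfy `γ_p ≡ M (mod p^v)` and `γ_p ≡ 1₄ (mod N p^{−v})`. Set
`U_p = γ_p · diag(p^v, p^v, 1, 1)`. Then `U_p² ∈ p^v Γ^para(N)`, i.e. there exists
`δ ∈ Γ^para(N)` with `U_p² = p^v · δ`. -/
theorem atkin_lehner_square (N p : ℕ) (hN : 0 < N) (hp : p.Prime) (hpN : p ∣ N)
    (v : ℕ) (hv : v = N.factorization p)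
    (γ : Matrix (Fin 4) (Fin 4) ℤ)
    (hγSp : γᵀ * Jmat ℤ * γ = Jmat ℤ)
    (hγM : ∀ i j : Fin 4, ((p : ℤ) ^ v) ∣ (γ i j - Mmat i j))
    (hγ1 : ∀ i j : Fin 4, ((N / p ^ v : ℕ) : ℤ) ∣
      (γ i j - (1 : Matrix (Fin 4) (Fin 4) ℤ) i j))
    (U : Matrix (Fin 4) (Fin 4) ℚ)
    (hU : U = (γ.map (fun x => (x : ℚ))) *
      Matrix.diagonal ![(p : ℚ) ^ v, (p : ℚ) ^ v, 1, 1]) :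
    ∃ δ : Matrix (Fin 4) (Fin 4) ℚ, ParaMem N δ ∧ U * U = ((p : ℚ) ^ v) • δ := by
  subst hv
  have hq : ((p : ℤ) ^ N.factorization p) ≠ 0 :=
    pow_ne_zero _ (by exact_mod_cast hp.ne_zero)
  have hcop : IsCoprime ((p : ℤ) ^ N.factorization p)
      ((N / p ^ N.factorization p : ℕ) : ℤ) := by
    have h := (Nat.coprime_ordCompl hp hN.ne').pow_left (N.factorization p)
    exact_mod_cast Nat.isCoprime_iff_coprime.mpr h
  have hNqm : (N : ℤ) = (p : ℤ) ^ N.factorization p *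
      ((N / p ^ N.factorization p : ℕ) : ℤ) := by
    exact_mod_cast (Nat.ordProj_mul_ordCompl_eq_self N p).symm
  have hcast : ((p : ℚ) ^ N.factorization p) = (((p : ℤ) ^ N.factorization p : ℤ) : ℚ) := by
    push_cast
    rfl
  rw [hcast] at hU ⊢
  generalize (p : ℤ) ^ N.factorization p = q at *
  generalize ((N / p ^ N.factorization p : ℕ) : ℤ) = m at *
  obtain ⟨X, hX⟩ := exists_eq_add_smul q γ Mmat hγM
  obtain ⟨Y, hY⟩ := exists_eq_add_smul m γ 1 hγ1
  have hsq : γ * scaleDiag q * (γ * scaleDiag q) = q • squareQuotient q X := by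
    rw [hX]
    exact mul_scaleDiag_sq q X
  have hsim : (γ * scaleDiag q)ᵀ * Jmat ℤ * (γ * scaleDiag q) = q • Jmat ℤ := by
    rw [← scaleDiag_symplectic q, Matrix.transpose_mul]
    nth_rewrite 2 [← hγSp]
    simp only [Matrix.mul_assoc]
  have hUE : U = (γ * scaleDiag q).map (Int.castRingHom ℚ) := by
    rw [hU, Matrix.map_mul]
    congr 1
    ext i j
    fin_cases i <;> fin_cases j <;> simp [scaleDiag]
  refine ⟨(squareQuotient q X).map (fun x => (x : ℚ)),
    paraMem_map_intCast hN _ (symplectic_of_sq_eq_smul hq hsim hsq) ?_, ?_⟩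
  · intro i j hij h _
    rw [hNqm]
    refine hcop.mul_dvd (dvd_squareQuotient q X i j hij h) (hcop.symm.dvd_of_dvd_mul_left ?_)
    have hm := dvd_sq_of_eq_one_add_smul q m Y i j hij
    rwa [← hY, hsq, Matrix.smul_apply, smul_eq_mul] at hm
  · rw [hUE, ← Matrix.map_mul, hsq]
    ext i j
    simp only [Matrix.map_apply, Matrix.smul_apply, smul_eq_mul, map_mul, eq_intCast]
end
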